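/- The dyadic Hardy space H₁(δ) on [0,1] is lattice-isomorphic to the dyadic Hardy space H₁(δ∞) on ℝ; equivalently, the normalized unconditional Haar bases of the two spaces are permutatively equivalent. -/

import Mathlib

open MeasureTheory

/-- The `L∞`-normalized Haar function adapted to the dyadic interval
`I_{nk} = [k2ⁿ, (k+1)2ⁿ]` (`n, k ∈ ℤ`). -/
noncomputable def haarR (n k : ℤ) (t : ℝ) : ℝ :=
  if t ∈ Set.Ico ((k : ℝ) * 2 ^ n) (((k : ℝ) + 1/2) * 2 ^ n) then 1
  else if t ∈ Set.Ico (((k : ℝ) + 1/2) * 2 ^ n) (((k : ℝ) + 1) * 2 ^ n) then -1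
  else 0

/-- The Haar function `h_{jk}` on `[0,1]`, `j ∈ ℕ`, `0 ≤ k < 2^j`. -/
noncomputable def haar01 (j k : ℕ) (t : ℝ) : ℝ := haarR (-(j : ℤ)) (k : ℤ) t

/-- Index set for the Haar functions on `[0,1]` (other than the constant function). -/
def HaarIdx : Type := {p : ℕ × ℕ // p.2 < 2 ^ p.1}

/-- The square-function norm of `H₁(δ)`: for coefficients `b` (w.r.t. the constant function
`χ_{[0,1]}` at `none` and the Haar functions at `some p`),
`‖∑ b_i h_i‖ = ∫₀¹ (∑ b_i² h_i²)^{1/2} dt`. -/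
noncomputable def H1deltaNorm (b : Option HaarIdx → ℝ) : ℝ :=
  ∫ t in Set.Icc (0:ℝ) 1,
    Real.sqrt ((b none) ^ 2 + ∑' p : HaarIdx, (b (some p) * haar01 p.1.1 p.1.2 t) ^ 2)

/-- The square-function norm of the dyadic `H₁(δ∞)` on `ℝ`:
`‖∑ c_{nk} h_{nk}‖ = ∫_ℝ (∑ c_{nk}² h_{nk}²)^{1/2} dt`. -/
noncomputable def H1deltaInfNorm (c : ℤ × ℤ → ℝ) : ℝ :=
  ∫ t : ℝ, Real.sqrt (∑' q : ℤ × ℤ, (c q * haarR q.1 q.2 t) ^ 2)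

/-- The `H₁(δ)`-norm of the basis element indexed by `i` (`∫|h| = 2^{-j}` at level `j`). -/
noncomputable def nu1 : Option HaarIdx → ℝ
  | none => 1
  | some p => (2 : ℝ) ^ (-(p.1.1 : ℤ))

/-- The `H₁(δ∞)`-norm of the Haar function `h_{nk}`, namely `2ⁿ`. -/
noncomputable def nuR (q : ℤ × ℤ) : ℝ := (2 : ℝ) ^ q.1

/-- The dyadic interval `I_{nk} = [k2ⁿ, (k+1)2ⁿ)`, `q = (n, k)`. -/
def dyadicCell (q : ℤ × ℤ) : Set ℝ :=
  Set.Ico ((q.2 : ℝ) * 2 ^ q.1) (((q.2 : ℝ) + 1) * 2 ^ q.1)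

/-- The length `2ⁿ` of a dyadic interval of generation `n`, in `ℝ≥0∞`. -/
noncomputable def dyadicLen (n : ℤ) : ENNReal := ENNReal.ofReal ((2 : ℝ) ^ n)

lemma dyadicLen_add (m n : ℤ) : dyadicLen (m + n) = dyadicLen m * dyadicLen n := by
  unfold dyadicLen
  rw [zpow_add₀ two_ne_zero, ENNReal.ofReal_mul (by positivity)]

lemma dyadicLen_zero : dyadicLen 0 = 1 := by simp [dyadicLen]

lemma dyadicLen_two : dyadicLen 2 = 4 := by
  unfold dyadicLen
  norm_num

lemma dyadicLen_mono {m n : ℤ} (h : m ≤ n) : dyadicLen m ≤ dyadicLen n :=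
  ENNReal.ofReal_le_ofReal (zpow_le_zpow_right₀ one_le_two h)

lemma dyadicLen_neg_mul (n : ℤ) : dyadicLen (-n) * dyadicLen n = 1 := by
  rw [← dyadicLen_add, neg_add_cancel, dyadicLen_zero]

lemma measurableSet_dyadicCell (q : ℤ × ℤ) : MeasurableSet (dyadicCell q) := measurableSet_Ico

lemma volume_dyadicCell (q : ℤ × ℤ) : volume (dyadicCell q) = dyadicLen q.1 := by
  unfold dyadicCell dyadicLen
  rw [Real.volume_Ico]
  congr 1
  ring

/-- The square of the (weighted) normalized Haar function `v h_{nk} / 2ⁿ`. -/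
noncomputable def sqTerm (q : ℤ × ℤ) (v : ENNReal) : ℝ → ENNReal :=
  (dyadicCell q).indicator fun _ => (v * dyadicLen (-q.1)) ^ 2

/-- The square function of `∑ i, x i • h_{φ i} / ‖h_{φ i}‖`. -/
noncomputable def sqFun {ι : Type*} (φ : ι → ℤ × ℤ) (x : ι → ENNReal) (t : ℝ) : ENNReal :=
  (∑' i, sqTerm (φ i) (x i) t) ^ (1 / 2 : ℝ)

/-- The `L¹`-norm of the square function of `∑ i, x i • h_{φ i} / ‖h_{φ i}‖`. -/
noncomputable def sqNorm {ι : Type*} (φ : ι → ℤ × ℤ) (x : ι → ENNReal) : ENNReal :=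
  ∫⁻ t, sqFun φ x t

lemma measurable_sqTerm (q : ℤ × ℤ) (v : ENNReal) : Measurable (sqTerm q v) :=
  measurable_const.indicator (measurableSet_dyadicCell q)

lemma measurable_sqFun {ι : Type*} [Countable ι] (φ : ι → ℤ × ℤ) (x : ι → ENNReal) :
    Measurable (sqFun φ x) :=
  (Measurable.tsum fun i => measurable_sqTerm (φ i) (x i)).pow_const _

/-- Subadditivity of the square root for arbitrary sums in `ℝ≥0∞`. -/
lemma tsum_rpow_half_le {ι : Type*} (u : ι → ENNReal) :
    (∑' i, u i) ^ (1 / 2 : ℝ) ≤ ∑' i, u i ^ (1 / 2 : ℝ) := by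
  set S := ∑' i, u i ^ (1 / 2 : ℝ) with hS
  have sq (y : ENNReal) : y ^ (1 / 2 : ℝ) * y ^ (1 / 2 : ℝ) = y := by
    rw [← ENNReal.rpow_add_of_nonneg _ _ (by norm_num) (by norm_num)]
    norm_num
  have h : ∑' i, u i ≤ S * S := by
    calc ∑' i, u i = ∑' i, u i ^ (1 / 2 : ℝ) * u i ^ (1 / 2 : ℝ) := by simp only [sq]
      _ ≤ ∑' i, S * u i ^ (1 / 2 : ℝ) :=
          ENNReal.tsum_le_tsum fun i => mul_le_mul_left (ENNReal.le_tsum i) _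
      _ = S * S := by rw [ENNReal.tsum_mul_left]
  calc (∑' i, u i) ^ (1 / 2 : ℝ) ≤ (S * S) ^ (1 / 2 : ℝ) :=
        ENNReal.rpow_le_rpow h (by norm_num)
    _ = S := by rw [ENNReal.mul_rpow_of_nonneg _ _ (by norm_num), sq]

lemma sqTerm_rpow_half (q : ℤ × ℤ) (v : ENNReal) (t : ℝ) :
    sqTerm q v t ^ (1 / 2 : ℝ)
      = (dyadicCell q).indicator (fun _ => v * dyadicLen (-q.1)) t := by
  unfold sqTerm
  by_cases h : t ∈ dyadicCell q
  · rw [Set.indicator_of_mem h, Set.indicator_of_mem h, ← ENNReal.rpow_two, ← ENNReal.rpow_mul]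
    norm_num
  · rw [Set.indicator_of_notMem h, Set.indicator_of_notMem h, ENNReal.zero_rpow_of_pos]
    norm_num

lemma lintegral_sqTerm_rpow_half (q : ℤ × ℤ) (v : ENNReal) :
    ∫⁻ t, sqTerm q v t ^ (1 / 2 : ℝ) = v := by
  simp only [sqTerm_rpow_half]
  rw [lintegral_indicator_const (measurableSet_dyadicCell q), volume_dyadicCell, mul_assoc,
    dyadicLen_neg_mul, mul_one]

lemma sqNorm_le_tsum {ι : Type*} [Countable ι] (φ : ι → ℤ × ℤ) (x : ι → ENNReal) :
    sqNorm φ x ≤ ∑' i, x i := by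
  calc sqNorm φ x ≤ ∫⁻ t, ∑' i, sqTerm (φ i) (x i) t ^ (1 / 2 : ℝ) :=
        lintegral_mono fun t => tsum_rpow_half_le _
    _ = ∑' i, x i := by
        rw [lintegral_tsum fun i => ((measurable_sqTerm _ _).pow_const _).aemeasurable]
        simp only [lintegral_sqTerm_rpow_half]

lemma sqNorm_comp_equiv {ι κ : Type*} (e : ι ≃ κ) (φ : κ → ℤ × ℤ) (x : κ → ENNReal) :
    sqNorm (φ ∘ e) (x ∘ e) = sqNorm φ x := by
  unfold sqNorm sqFun
  refine lintegral_congr fun t => ?_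
  congr 1
  exact e.tsum_eq fun i => sqTerm (φ i) (x i) t

/-- The position in `ℤ × ℤ` of a dyadic subinterval of `[0,1]`. -/
def unitCell (p : HaarIdx) : ℤ × ℤ := (-(p.1.1 : ℤ), (p.1.2 : ℤ))

/-- The position in `ℤ × ℤ` of the copy of a dyadic subinterval of `[0,1]` under the affine map of
`[0,1]` onto the dyadic interval `b`. -/
def subCell (b : ℤ × ℤ) (p : HaarIdx) : ℤ × ℤ :=
  (b.1 - (p.1.1 : ℤ), (p.1.2 : ℤ) + b.2 * 2 ^ p.1.1)

instance : Countable HaarIdx := inferInstanceAs (Countable {p : ℕ × ℕ // p.2 < 2 ^ p.1})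

lemma mem_dyadicCell_subCell (b : ℤ × ℤ) (p : HaarIdx) (t : ℝ) :
    t ∈ dyadicCell (subCell b p) ↔ 2 ^ (-b.1) * t + (-b.2 : ℝ) ∈ dyadicCell (unitCell p) := by
  obtain ⟨m, s⟩ := b
  have hm : (0 : ℝ) < 2 ^ m := by positivity
  have hj : (0 : ℝ) < 2 ^ p.1.1 := by positivity
  simp only [dyadicCell, subCell, unitCell, Set.mem_Ico, zpow_sub₀ (two_ne_zero' ℝ), zpow_neg,
    zpow_natCast]
  push_cast
  generalize (2 : ℝ) ^ m = M at *
  generalize (2 : ℝ) ^ p.1.1 = J at *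
  have e1 : ∀ c : ℝ, (c + s * J) * (M / J) = M * (c * J⁻¹ + s) := by
    intro c; field_simp
  have e3 : ((p.1.2 : ℝ) + s * J + 1) = (p.1.2 + 1) + s * J := by ring
  rw [e3, e1, e1, ← sub_eq_add_neg, le_sub_iff_add_le, sub_lt_iff_lt_add, le_inv_mul_iff₀ hm,
    inv_mul_lt_iff₀ hm]

lemma subCell_subset (b : ℤ × ℤ) (p : HaarIdx) : dyadicCell (subCell b p) ⊆ dyadicCell b := by
  intro t ht
  rw [mem_dyadicCell_subCell] at ht
  obtain ⟨m, s⟩ := b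
  have hm : (0 : ℝ) < 2 ^ m := by positivity
  have hj : (0 : ℝ) < 2 ^ p.1.1 := by positivity
  have hk : (p.1.2 : ℝ) + 1 ≤ 2 ^ p.1.1 := by exact_mod_cast p.2
  simp only [dyadicCell, unitCell, Set.mem_Ico, zpow_neg, zpow_natCast] at ht ⊢
  push_cast at ht
  obtain ⟨h1, h2⟩ := ht
  have h3 : (0 : ℝ) ≤ p.1.2 * (2 ^ p.1.1)⁻¹ := by positivity
  have h4 : ((p.1.2 : ℝ) + 1) * (2 ^ p.1.1)⁻¹ ≤ 1 := by
    rw [mul_inv_le_iff₀ hj]; linarith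
  constructor
  · have : (s : ℝ) ≤ (2 ^ m)⁻¹ * t := by linarith
    rw [le_inv_mul_iff₀ hm] at this
    linarith
  · have : (2 ^ m)⁻¹ * t < (s : ℝ) + 1 := by linarith
    rw [inv_mul_lt_iff₀ hm] at this
    linarith

lemma sqTerm_subCell (b : ℤ × ℤ) (p : HaarIdx) (v : ENNReal) (t : ℝ) :
    sqTerm (subCell b p) v t
      = dyadicLen (-b.1) ^ 2 * sqTerm (unitCell p) v (2 ^ (-b.1) * t + (-b.2 : ℝ)) := by
  unfold sqTerm
  have h := mem_dyadicCell_subCell b p t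
  by_cases ht : t ∈ dyadicCell (subCell b p)
  · rw [Set.indicator_of_mem ht, Set.indicator_of_mem (h.1 ht), ← mul_pow]
    have : -(subCell b p).1 = -b.1 + -(unitCell p).1 := by simp [subCell, unitCell]; ring
    rw [this, dyadicLen_add]
    ring
  · rw [Set.indicator_of_notMem ht, Set.indicator_of_notMem (mt h.2 ht), mul_zero]

lemma lintegral_comp_mul_add (f : ℝ → ENNReal) (hf : Measurable f) {a : ℝ} (ha : 0 < a) (c : ℝ) :
    ∫⁻ t, f (a * t + c) = ENNReal.ofReal a⁻¹ * ∫⁻ t, f t := by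
  have h1 : Measurable fun t : ℝ => f (t + c) := by fun_prop
  rw [← lintegral_map (f := fun t => f (t + c)) (g := fun t : ℝ => a * t) h1 (by fun_prop),
    Real.map_volume_mul_left ha.ne', lintegral_smul_measure, lintegral_add_right_eq_self f c,
    abs_of_pos (inv_pos.2 ha), smul_eq_mul]

/-- The norm is invariant under moving `[0,1]` onto another dyadic interval. -/
lemma sqNorm_subCell (b : ℤ × ℤ) (x : HaarIdx → ENNReal) :
    sqNorm (subCell b) x = sqNorm unitCell x := by
  unfold sqNorm
  have h (t : ℝ) : sqFun (subCell b) x t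
      = dyadicLen (-b.1) * sqFun unitCell x (2 ^ (-b.1) * t + (-b.2 : ℝ)) := by
    unfold sqFun
    simp only [sqTerm_subCell]
    rw [ENNReal.tsum_mul_left, ENNReal.mul_rpow_of_nonneg _ _ (by norm_num), ← ENNReal.rpow_two,
      ← ENNReal.rpow_mul]
    norm_num
  simp only [h]
  rw [lintegral_const_mul' (dyadicLen (-b.1)) _ ENNReal.ofReal_ne_top,
    lintegral_comp_mul_add _ (measurable_sqFun _ _) (by positivity), ← mul_assoc]
  rw [← zpow_neg, neg_neg]
  change dyadicLen (-b.1) * dyadicLen b.1 * _ = _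
  rw [dyadicLen_neg_mul, one_mul]

section Decomposition

variable {A B : Type*}

/-- The Haar system made of the dyadic intervals `top a` and of the subintervals of the dyadic
intervals `blk b`. -/
def assemble (top : A → ℤ × ℤ) (blk : B → ℤ × ℤ) : A ⊕ (B × HaarIdx) → ℤ × ℤ :=
  Sum.elim top fun i => subCell (blk i.1) i.2

/-- The norm of `ℓ₁(A) ⊕ ℓ₁(B; H₁)`. -/
noncomputable def mixedNorm (x : A ⊕ (B × HaarIdx) → ENNReal) : ENNReal :=
  (∑' a, x (Sum.inl a)) + ∑' b, sqNorm unitCell fun p => x (Sum.inr (b, p))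

lemma mixedNorm_comp_equiv {A' B' : Type*} (eA : A ≃ A') (eB : B ≃ B')
    (x : A' ⊕ (B' × HaarIdx) → ENNReal) :
    mixedNorm (x ∘ Equiv.sumCongr eA (Equiv.prodCongr eB (Equiv.refl HaarIdx))) = mixedNorm x := by
  unfold mixedNorm
  congr 1
  · exact eA.tsum_eq fun a => x (Sum.inl a)
  · exact eB.tsum_eq fun b => sqNorm unitCell fun p => x (Sum.inr (b, p))

lemma tsum_sum_type (f : A ⊕ B → ENNReal) :
    ∑' i, f i = (∑' a, f (Sum.inl a)) + ∑' b, f (Sum.inr b) :=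
  Summable.tsum_sum ENNReal.summable ENNReal.summable

lemma sqNorm_assemble_le [Countable A] [Countable B] (top : A → ℤ × ℤ) (blk : B → ℤ × ℤ)
    (x : A ⊕ (B × HaarIdx) → ENNReal) : sqNorm (assemble top blk) x ≤ mixedNorm x := by
  have h (t : ℝ) : sqFun (assemble top blk) x t ≤
      (∑' a, sqTerm (top a) (x (Sum.inl a)) t ^ (1 / 2 : ℝ)) +
        ∑' b, sqFun (subCell (blk b)) (fun p => x (Sum.inr (b, p))) t := by
    unfold sqFun
    rw [tsum_sum_type, ENNReal.tsum_prod']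
    refine (ENNReal.rpow_add_le_add_rpow _ _ (by norm_num) (by norm_num)).trans ?_
    exact add_le_add (tsum_rpow_half_le _) (tsum_rpow_half_le _)
  refine (lintegral_mono h).trans_eq ?_
  rw [lintegral_add_left (Measurable.tsum fun a => (measurable_sqTerm _ _).pow_const _),
    lintegral_tsum fun i => ((measurable_sqTerm _ _).pow_const _).aemeasurable,
    lintegral_tsum fun i => (measurable_sqFun _ _).aemeasurable]
  simp only [lintegral_sqTerm_rpow_half]
  congr 1
  exact tsum_congr fun b => sqNorm_subCell _ _

lemma tsum_setLIntegral_le {ι : Type*} [Countable ι] {c : ι → ℤ × ℤ}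
    (hc : Pairwise (Function.onFun Disjoint fun i => dyadicCell (c i))) (f : ℝ → ENNReal) :
    ∑' i, ∫⁻ t in dyadicCell (c i), f t ≤ ∫⁻ t, f t := by
  rw [← lintegral_iUnion (fun i => measurableSet_dyadicCell _) hc]
  exact setLIntegral_le_lintegral _ _

lemma mixedNorm_le [Countable A] [Countable B] (top : A → ℤ × ℤ) (blk : B → ℤ × ℤ)
    (hblk : Pairwise (Function.onFun Disjoint fun b => dyadicCell (blk b)))
    (core : A → ℤ × ℤ) (hcore : Pairwise (Function.onFun Disjoint fun a => dyadicCell (core a)))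
    (hsub : ∀ a, dyadicCell (core a) ⊆ dyadicCell (top a)) (hlen : ∀ a, (top a).1 ≤ (core a).1 + 2)
    (x : A ⊕ (B × HaarIdx) → ENNReal) :
    mixedNorm x ≤ 5 * sqNorm (assemble top blk) x := by
  have h1 : ∑' a, x (Sum.inl a) ≤ 4 * sqNorm (assemble top blk) x := by
    refine le_trans ?_ (mul_le_mul_right (tsum_setLIntegral_le hcore _) 4)
    rw [← ENNReal.tsum_mul_left]
    refine ENNReal.tsum_le_tsum fun a => ?_
    have hle : ∀ t ∈ dyadicCell (core a),
        x (Sum.inl a) * dyadicLen (-(top a).1) ≤ sqFun (assemble top blk) x t := by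
      intro t ht
      have := sqTerm_rpow_half (top a) (x (Sum.inl a)) t
      rw [Set.indicator_of_mem (hsub a ht)] at this
      rw [← this]
      exact ENNReal.rpow_le_rpow
        (ENNReal.le_tsum (f := fun i => sqTerm (assemble top blk i) (x i) t) (Sum.inl a))
        (by norm_num)
    calc x (Sum.inl a) = x (Sum.inl a) * (dyadicLen (-(top a).1) * dyadicLen (top a).1) := by
          rw [dyadicLen_neg_mul, mul_one]
      _ ≤ x (Sum.inl a) * (dyadicLen (-(top a).1) * dyadicLen ((core a).1 + 2)) := by
          gcongr
          exact dyadicLen_mono (hlen a)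
      _ = 4 * ∫⁻ t in dyadicCell (core a), x (Sum.inl a) * dyadicLen (-(top a).1) := by
          rw [setLIntegral_const, volume_dyadicCell, dyadicLen_add, dyadicLen_two]
          ring
      _ ≤ _ := by
          gcongr 4 * ?_
          exact setLIntegral_mono' (measurableSet_dyadicCell _) hle
  have h2 : ∑' b, sqNorm unitCell (fun p => x (Sum.inr (b, p))) ≤ sqNorm (assemble top blk) x := by
    refine le_trans (ENNReal.tsum_le_tsum fun b => ?_) (tsum_setLIntegral_le hblk _)
    rw [← sqNorm_subCell (blk b), sqNorm, ← lintegral_indicator (measurableSet_dyadicCell _)]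
    refine lintegral_mono fun t => ?_
    by_cases ht : t ∈ dyadicCell (blk b)
    · rw [Set.indicator_of_mem ht]
      refine ENNReal.rpow_le_rpow ?_ (by norm_num)
      exact ENNReal.tsum_comp_le_tsum_of_injective
        (f := fun p : HaarIdx => (Sum.inr (b, p) : A ⊕ (B × HaarIdx)))
        (fun p p' h => by simpa using h) fun i => sqTerm (assemble top blk i) (x i) t
    · have h0 : ∀ p, sqTerm (subCell (blk b) p) (x (Sum.inr (b, p))) t = 0 := fun p =>
        Set.indicator_of_notMem (fun h => ht (subCell_subset _ _ h)) _
      simp [sqFun, h0]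
  calc mixedNorm x ≤ 4 * sqNorm (assemble top blk) x + sqNorm (assemble top blk) x :=
        add_le_add h1 h2
    _ = 5 * sqNorm (assemble top blk) x := by ring

end Decomposition

lemma haarR_sq (q : ℤ × ℤ) (t : ℝ) :
    haarR q.1 q.2 t ^ 2 = (dyadicCell q).indicator (fun _ => (1 : ℝ)) t := by
  have hn : (0 : ℝ) < 2 ^ q.1 := by positivity
  have h1 : (q.2 : ℝ) * 2 ^ q.1 ≤ (q.2 + 1 / 2) * 2 ^ q.1 := by nlinarith
  have h2 : ((q.2 : ℝ) + 1 / 2) * 2 ^ q.1 ≤ (q.2 + 1) * 2 ^ q.1 := by nlinarith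
  have hun : t ∈ dyadicCell q ↔
      t ∈ Set.Ico ((q.2 : ℝ) * 2 ^ q.1) (((q.2 : ℝ) + 1/2) * 2 ^ q.1) ∨
      t ∈ Set.Ico (((q.2 : ℝ) + 1/2) * 2 ^ q.1) (((q.2 : ℝ) + 1) * 2 ^ q.1) := by
    rw [← Set.mem_union, Set.Ico_union_Ico_eq_Ico h1 h2, dyadicCell]
  by_cases ht : t ∈ dyadicCell q
  · rw [Set.indicator_of_mem ht]
    unfold haarR
    split_ifs with ha hb
    · norm_num
    · norm_num
    · exact absurd (hun.1 ht) (by tauto)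
  · rw [Set.indicator_of_notMem ht]
    unfold haarR
    rw [if_neg fun h => ht (hun.2 (Or.inl h)), if_neg fun h => ht (hun.2 (Or.inr h))]
    norm_num

lemma ofReal_sq_haarR (q : ℤ × ℤ) (v t : ℝ) :
    ENNReal.ofReal ((v * (nuR q)⁻¹ * haarR q.1 q.2 t) ^ 2)
      = sqTerm q (ENNReal.ofReal |v|) t := by
  rw [mul_pow, haarR_sq]
  unfold sqTerm
  by_cases ht : t ∈ dyadicCell q
  · rw [Set.indicator_of_mem ht, Set.indicator_of_mem ht, mul_one, dyadicLen,
      ← ENNReal.ofReal_mul (abs_nonneg v), ← ENNReal.ofReal_pow (by positivity), zpow_neg, nuR,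
      mul_pow, mul_pow, sq_abs]
  · rw [Set.indicator_of_notMem ht, Set.indicator_of_notMem ht, mul_zero, ENNReal.ofReal_zero]

lemma sqrt_tsum_eq_toReal_sqFun {ι : Type*} (φ : ι → ℤ × ℤ) (a : ι → ℝ)
    (ha : (Function.support a).Finite) (t : ℝ) :
    √(∑' i, (a i * (nuR (φ i))⁻¹ * haarR (φ i).1 (φ i).2 t) ^ 2)
      = (sqFun φ (fun i => ENNReal.ofReal |a i|) t).toReal := by
  have hs : Summable fun i => (a i * (nuR (φ i))⁻¹ * haarR (φ i).1 (φ i).2 t) ^ 2 := by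
    refine summable_of_hasFiniteSupport (ha.subset fun i hi => ?_)
    rw [Function.mem_support] at hi ⊢
    rintro h
    simp [h] at hi
  have h0 : ∀ i, 0 ≤ (a i * (nuR (φ i))⁻¹ * haarR (φ i).1 (φ i).2 t) ^ 2 := fun i => sq_nonneg _
  unfold sqFun
  simp only [← ofReal_sq_haarR]
  rw [← ENNReal.ofReal_tsum_of_nonneg h0 hs, ENNReal.ofReal_rpow_of_nonneg (tsum_nonneg h0)
    (by norm_num), ENNReal.toReal_ofReal (by positivity), Real.sqrt_eq_rpow]

lemma sqNorm_ne_top {ι : Type*} [Countable ι] (φ : ι → ℤ × ℤ) (a : ι → ℝ)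
    (ha : (Function.support a).Finite) : sqNorm φ (fun i => ENNReal.ofReal |a i|) ≠ ⊤ := by
  refine ne_top_of_le_ne_top ?_ (sqNorm_le_tsum φ _)
  have hs : Summable fun i => |a i| := by
    refine summable_of_hasFiniteSupport (ha.subset fun i hi => ?_)
    simpa using hi
  rw [← ENNReal.ofReal_tsum_of_nonneg (fun i => abs_nonneg _) hs]
  exact ENNReal.ofReal_ne_top

lemma integral_sqrt_tsum_eq_toReal_sqNorm {ι : Type*} [Countable ι] (φ : ι → ℤ × ℤ) (a : ι → ℝ)
    (ha : (Function.support a).Finite) :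
    ∫ t, √(∑' i, (a i * (nuR (φ i))⁻¹ * haarR (φ i).1 (φ i).2 t) ^ 2)
      = (sqNorm φ (fun i => ENNReal.ofReal |a i|)).toReal := by
  simp only [sqrt_tsum_eq_toReal_sqFun φ a ha]
  rw [integral_toReal (measurable_sqFun _ _).aemeasurable]
  · rfl
  · exact ae_lt_top (measurable_sqFun _ _) (sqNorm_ne_top φ a ha)

lemma H1deltaInfNorm_eq (a : ℤ × ℤ → ℝ) (ha : (Function.support a).Finite) :
    H1deltaInfNorm (fun q => a q * (nuR q)⁻¹)
      = (sqNorm id (fun q => ENNReal.ofReal |a q|)).toReal :=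
  integral_sqrt_tsum_eq_toReal_sqNorm id a ha

/-- The positions in `ℤ × ℤ` of the Haar functions of `[0,1]`; the constant function is placed
on `[0,1]`. -/
def idxCell (i : Option HaarIdx) : ℤ × ℤ := i.elim (0, 0) unitCell

lemma dyadicCell_zero : dyadicCell (0, 0) = Set.Ico 0 1 := by simp [dyadicCell]

lemma subCell_zero (p : HaarIdx) : subCell (0, 0) p = unitCell p := by
  simp [subCell, unitCell]

lemma idxCell_subset (i : Option HaarIdx) : dyadicCell (idxCell i) ⊆ Set.Ico 0 1 := by
  rw [← dyadicCell_zero]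
  cases i with
  | none => exact subset_rfl
  | some p =>
    have h := subCell_subset (0, 0) p
    rwa [subCell_zero] at h

lemma nuR_idxCell (i : Option HaarIdx) : nuR (idxCell i) = nu1 i := by
  cases i <;> simp [nuR, nu1, idxCell, unitCell]

lemma tsum_option {ι : Type*} (f : Option ι → ℝ) (hf : Summable f) :
    ∑' i, f i = f none + ∑' i, f (some i) := by
  have hf' := (Equiv.optionEquivSumPUnit.{0} ι).symm.summable_iff.2 hf
  rw [← (Equiv.optionEquivSumPUnit.{0} ι).symm.tsum_eq]
  refine (Summable.tsum_sum (hf'.comp_injective Sum.inl_injective)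
    (hf'.comp_injective Sum.inr_injective)).trans ?_
  rw [add_comm]
  simp

lemma H1deltaNorm_eq (a : Option HaarIdx → ℝ) (ha : (Function.support a).Finite) :
    H1deltaNorm (fun i => a i * (nu1 i)⁻¹)
      = (sqNorm idxCell (fun i => ENNReal.ofReal |a i|)).toReal := by
  rw [← integral_sqrt_tsum_eq_toReal_sqNorm idxCell a ha, H1deltaNorm, integral_Icc_eq_integral_Ico]
  refine Eq.trans ?_ (setIntegral_eq_integral_of_forall_compl_eq_zero
    (s := Set.Ico (0 : ℝ) 1) ?_)
  · refine setIntegral_congr_fun measurableSet_Ico fun t ht => ?_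
    have hs : Summable fun i : Option HaarIdx =>
        (a i * (nuR (idxCell i))⁻¹ * haarR (idxCell i).1 (idxCell i).2 t) ^ 2 := by
      refine summable_of_hasFiniteSupport (ha.subset fun i hi => ?_)
      rw [Function.mem_support] at hi ⊢
      rintro h
      simp [h] at hi
    rw [tsum_option _ hs]
    have h0 := haarR_sq (0, 0) t
    rw [dyadicCell_zero, Set.indicator_of_mem ht] at h0
    simp only [nuR_idxCell]
    simp [mul_pow, idxCell, h0, haar01, unitCell]
  · intro t ht
    have h0 : ∀ i, haarR (idxCell i).1 (idxCell i).2 t ^ 2 = 0 := fun i => by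
      rw [haarR_sq, Set.indicator_of_notMem fun h => ht (idxCell_subset i h)]
    simp [mul_pow, h0]

/-- The dyadic interval `[2ᵐ, 2ᵐ⁺¹)` or `[-2ᵐ⁺¹, -2ᵐ)`. -/
def band (i : ℤ × Bool) : ℤ × ℤ := (i.1, cond i.2 1 (-2))

/-- The dyadic interval `[0, 2ᵐ)` or `[-2ᵐ, 0)`. -/
def topCell (i : ℤ × Bool) : ℤ × ℤ := (i.1, cond i.2 0 (-1))

lemma pairwise_disjoint_band :
    Pairwise (Function.onFun Disjoint fun i => dyadicCell (band i)) := by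
  have key : ∀ m n : ℤ, m < n → (2 : ℝ) * 2 ^ m ≤ 2 ^ n := fun m n h => by
    rw [mul_comm, ← zpow_add_one₀ two_ne_zero]
    exact zpow_le_zpow_right₀ one_le_two h
  rintro ⟨m, s⟩ ⟨n, r⟩ hne
  refine Set.disjoint_left.2 fun t h1 h2 => hne ?_
  have hm : (0 : ℝ) < 2 ^ m := by positivity
  have hn : (0 : ℝ) < 2 ^ n := by positivity
  simp only [dyadicCell, band, Set.mem_Ico] at h1 h2
  rcases lt_trichotomy m n with h | rfl | h
  · have := key m n h
    cases s <;> cases r <;> simp at h1 h2 ⊢ <;> linarith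
  · cases s <;> cases r <;> simp at h1 h2 ⊢ <;> linarith
  · have := key n m h
    cases s <;> cases r <;> simp at h1 h2 ⊢ <;> linarith

lemma band_subset_topCell (m : ℤ) (s : Bool) :
    dyadicCell (band (m - 1, s)) ⊆ dyadicCell (topCell (m, s)) := by
  have hm : (0 : ℝ) < 2 ^ m := by positivity
  intro t ht
  simp only [dyadicCell, band, topCell, Set.mem_Ico, zpow_sub_one₀ (two_ne_zero' ℝ)] at ht ⊢
  cases s <;> simp at ht ⊢ <;> constructor <;> linarith

lemma subCell_band_injective :
    Function.Injective fun i : (ℤ × Bool) × HaarIdx => subCell (band i.1) i.2 := by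
  have key : ∀ i j : ℕ, i < j → 2 * (2 : ℤ) ^ i ≤ 2 ^ j := fun i j h => by
    rw [← pow_succ']
    exact pow_le_pow_right₀ one_le_two h
  rintro ⟨⟨m, s⟩, ⟨⟨i, k⟩, hk⟩⟩ ⟨⟨n, r⟩, ⟨⟨j, l⟩, hl⟩⟩ h
  simp only [subCell, band, Prod.mk.injEq] at h
  obtain ⟨h1, h2⟩ := h
  have hk' : (k : ℤ) < 2 ^ i := by exact_mod_cast hk
  have hl' : (l : ℤ) < 2 ^ j := by exact_mod_cast hl
  have hij : i = j ∧ s = r := by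
    rcases lt_trichotomy i j with h | rfl | h
    · have := key i j h
      cases s <;> cases r <;> simp at h2 ⊢ <;> omega
    · cases s <;> cases r <;> simp at h2 ⊢ <;> omega
    · have := key j i h
      cases s <;> cases r <;> simp at h2 ⊢ <;> omega
  obtain ⟨rfl, rfl⟩ := hij
  obtain rfl : m = n := by omega
  obtain rfl : k = l := by omega
  rfl

lemma subCell_band_ne_topCell (i j : ℤ × Bool) (p : HaarIdx) :
    subCell (band i) p ≠ topCell j := by
  obtain ⟨⟨j', k⟩, hk⟩ := p
  obtain ⟨m, s⟩ := i
  obtain ⟨n, r⟩ := j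
  intro h
  simp only [subCell, band, topCell, Prod.mk.injEq] at h
  have hk' : (k : ℤ) < 2 ^ j' := by exact_mod_cast hk
  have h2 := h.2
  cases s <;> cases r <;> simp at h2 <;> omega

lemma exists_subCell_band {n k : ℤ} (h0 : k ≠ 0) (h1 : k ≠ -1) :
    ∃ i p, subCell (band i) p = (n, k) := by
  have key (l : ℕ) (hl : l ≠ 0) :
      (2 : ℤ) ^ Nat.log 2 l ≤ l ∧ (l : ℤ) < 2 * 2 ^ Nat.log 2 l := by
    constructor
    · exact_mod_cast Nat.pow_log_le_self 2 hl
    · rw [← pow_succ']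
      exact_mod_cast Nat.lt_pow_succ_log_self one_lt_two l
  rcases lt_or_ge k 0 with hk | hk
  · obtain ⟨l, rfl⟩ : ∃ l : ℕ, k = -(l : ℤ) - 1 := ⟨(-k - 1).toNat, by omega⟩
    obtain ⟨h2, h3⟩ := key l (by omega)
    set j := Nat.log 2 l
    refine ⟨(n + j, false), ⟨(j, 2 * 2 ^ j - 1 - l), ?_⟩, ?_⟩
    · have h2' : 2 ^ j ≤ l := by exact_mod_cast h2
      have h3' : l < 2 * 2 ^ j := by exact_mod_cast h3
      change 2 * 2 ^ j - 1 - l < 2 ^ j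
      omega
    · have : ((2 * 2 ^ j - 1 - l : ℕ) : ℤ) = 2 * 2 ^ j - 1 - l := by
        have : l + 1 ≤ 2 * 2 ^ j := by zify; omega
        push_cast [Nat.sub_sub, Nat.cast_sub (by omega : 1 + l ≤ 2 * 2 ^ j)]
        ring
      simp only [subCell, band, this, cond_false, Prod.mk.injEq]
      constructor <;> ring
  · lift k to ℕ using hk
    obtain ⟨h2, h3⟩ := key k (by omega)
    set j := Nat.log 2 k
    have h2' : 2 ^ j ≤ k := by exact_mod_cast h2
    have h3' : k < 2 * 2 ^ j := by exact_mod_cast h3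
    refine ⟨(n + j, true), ⟨(j, k - 2 ^ j), ?_⟩, ?_⟩
    · dsimp only
      omega
    · simp only [subCell, band, cond_true, Prod.mk.injEq]
      push_cast [Nat.cast_sub h2']
      constructor <;> ring

lemma assemble_band_bijective : Function.Bijective (assemble topCell band) := by
  constructor
  · rintro (⟨m, s⟩ | i) (⟨n, r⟩ | j) h
    · simp only [assemble, topCell, Sum.elim_inl, Prod.mk.injEq] at h
      obtain ⟨rfl, h⟩ := h
      cases s <;> cases r <;> simp at h ⊢
    · exact absurd h.symm (subCell_band_ne_topCell _ _ _)
    · exact absurd h (subCell_band_ne_topCell _ _ _)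
    · exact congrArg Sum.inr (subCell_band_injective h)
  · rintro ⟨n, k⟩
    by_cases h0 : k = 0
    · exact ⟨Sum.inl (n, true), by simp [assemble, topCell, h0]⟩
    by_cases h1 : k = -1
    · exact ⟨Sum.inl (n, false), by simp [assemble, topCell, h1]⟩
    obtain ⟨i, p, h⟩ := exists_subCell_band (n := n) h0 h1
    exact ⟨Sum.inr (i, p), h⟩

/-- The positions of the constant function (`none`) and of the Haar functions of `[0, 2⁻ʲ)`. -/
def unitTop (i : Option ℕ) : ℤ × ℤ := i.elim (0, 0) fun j => (-(j : ℤ), 0)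

/-- The dyadic interval `[2⁻ʲ⁻¹, 2⁻ʲ)`. -/
def unitBand (j : ℕ) : ℤ × ℤ := band (-(j : ℤ) - 1, true)

/-- Disjoint dyadic intervals witnessing the position of each interval `unitTop i`. -/
def unitCore (i : Option ℕ) : ℤ × ℤ := i.elim (-2, 3) fun j => (-(j : ℤ) - 2, 2)

/-- The index of the Haar function `h_{jk}` on `[0,1]`. -/
def haarIdx (j k : ℕ) (h : k < 2 ^ j) : HaarIdx := ⟨(j, k), h⟩

lemma unitCell_haarIdx (j k : ℕ) (h : k < 2 ^ j) : unitCell (haarIdx j k h) = (-(j : ℤ), (k : ℤ)) :=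
  rfl

/-- The enumeration of the Haar system of `[0,1]` by the intervals `[0, 2⁻ʲ)`
and the subintervals of `[2⁻ʲ⁻¹, 2⁻ʲ)`. -/
def unitSplit : Option ℕ ⊕ (ℕ × HaarIdx) → Option HaarIdx
  | Sum.inl none => none
  | Sum.inl (some j) => some (haarIdx j 0 (by positivity))
  | Sum.inr (i, p) => some (haarIdx (p.1.1 + i + 1) (p.1.2 + 2 ^ p.1.1) (by
      have h1 := p.2
      have h2 : 2 ^ (p.1.1 + 1) ≤ 2 ^ (p.1.1 + i + 1) :=
        Nat.pow_le_pow_right two_pos (by omega)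
      rw [pow_succ] at h2
      omega))

lemma idxCell_comp_unitSplit : idxCell ∘ unitSplit = assemble unitTop unitBand := by
  funext i
  rcases i with (_ | j) | ⟨i, p⟩
  · rfl
  · rfl
  · simp only [Function.comp, unitSplit, idxCell, assemble, unitBand, band, subCell,
      unitCell_haarIdx, Sum.elim_inr, Option.elim_some, cond_true, Prod.mk.injEq]
    push_cast
    constructor <;> ring

lemma unitSplit_bijective : Function.Bijective unitSplit := by
  constructor
  · have hT (i : ℕ × HaarIdx) (j : ℕ) : unitSplit (Sum.inr i) ≠ unitSplit (Sum.inl (some j)) :=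
      fun h => by
        have h' : (idxCell ∘ unitSplit) _ = (idxCell ∘ unitSplit) _ := congrArg idxCell h
        rw [idxCell_comp_unitSplit] at h'
        exact subCell_band_ne_topCell (-(i.1 : ℤ) - 1, true) (-(j : ℤ), true) i.2 h'
    rintro ((_ | j) | i) ((_ | j') | i') h
    · rfl
    · simp [unitSplit] at h
    · simp [unitSplit] at h
    · simp [unitSplit] at h
    · have := congrArg (fun o => (idxCell o).1) h
      simp only [unitSplit, idxCell, Option.elim_some, unitCell_haarIdx] at this
      rw [show j = j' by omega]
    · exact absurd h.symm (hT _ _)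
    · simp [unitSplit] at h
    · exact absurd h (hT _ _)
    · have h1 := congrFun idxCell_comp_unitSplit (Sum.inr i)
      have h2 := congrFun idxCell_comp_unitSplit (Sum.inr i')
      simp only [Function.comp, h] at h1 h2
      have h3 := h1.symm.trans h2
      have h4 := @subCell_band_injective ((-(i.1 : ℤ) - 1, true), i.2)
        ((-(i'.1 : ℤ) - 1, true), i'.2) h3
      simp only [Prod.mk.injEq] at h4
      congr 1
      refine Prod.ext ?_ h4.2
      have := h4.1.1
      omega
  · rintro (_ | ⟨⟨j, k⟩, hk⟩)
    · exact ⟨Sum.inl none, rfl⟩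
    · by_cases h0 : k = 0
      · subst h0
        exact ⟨Sum.inl (some j), rfl⟩
      · have h1 : 2 ^ Nat.log 2 k ≤ k := Nat.pow_log_le_self 2 h0
        have h2 : k < 2 ^ (Nat.log 2 k + 1) := Nat.lt_pow_succ_log_self one_lt_two k
        have h3 : Nat.log 2 k < j := Nat.log_lt_of_lt_pow h0 hk
        rw [pow_succ] at h2
        set i := Nat.log 2 k
        refine ⟨Sum.inr (j - 1 - i, ⟨(i, k - 2 ^ i), ?_⟩), ?_⟩
        · dsimp only
          omega
        · simp only [unitSplit, haarIdx]
          congr 3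
          · omega
          · exact Nat.sub_add_cancel h1

lemma pairwise_disjoint_unitBand :
    Pairwise (Function.onFun Disjoint fun j => dyadicCell (unitBand j)) := fun i j h =>
  pairwise_disjoint_band (i := (-(i : ℤ) - 1, true)) (j := (-(j : ℤ) - 1, true))
    (by simpa using h)

lemma unitCore_some_subset (j : ℕ) :
    dyadicCell (unitCore (some j)) ⊆ dyadicCell (unitBand j) := by
  have hm : (0 : ℝ) < 2 ^ (-(j : ℤ)) := by positivity
  intro t ht
  simp only [dyadicCell, unitCore, unitBand, band, Option.elim_some, cond_true, Set.mem_Ico,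
    zpow_sub₀ (two_ne_zero' ℝ)] at ht ⊢
  generalize (2 : ℝ) ^ (-(j : ℤ)) = M at *
  norm_num at ht ⊢
  constructor <;> linarith

lemma unitCore_subset (i : Option ℕ) : dyadicCell (unitCore i) ⊆ dyadicCell (unitTop i) := by
  cases i with
  | none =>
    intro t ht
    simp only [dyadicCell, unitCore, unitTop, Option.elim_none, Set.mem_Ico] at ht ⊢
    norm_num at ht ⊢
    constructor <;> linarith
  | some j =>
    refine (unitCore_some_subset j).trans ?_
    exact band_subset_topCell (-(j : ℤ)) true

lemma pairwise_disjoint_unitCore :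
    Pairwise (Function.onFun Disjoint fun i => dyadicCell (unitCore i)) := by
  have hnone (j : ℕ) : Disjoint (dyadicCell (unitCore none)) (dyadicCell (unitCore (some j))) := by
    refine Set.disjoint_left.2 fun t h1 h2 => ?_
    have hj : (2 : ℝ) ^ (-(j : ℤ)) ≤ 1 := zpow_le_one_of_nonpos₀ one_le_two (by omega)
    simp only [dyadicCell, unitCore, Option.elim_some, Option.elim_none, Set.mem_Ico,
      zpow_sub₀ (two_ne_zero' ℝ)] at h1 h2
    generalize (2 : ℝ) ^ (-(j : ℤ)) = M at *
    norm_num at h1 h2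
    linarith
  rintro (_ | i) (_ | j) h
  · exact absurd rfl h
  · exact hnone j
  · exact (hnone i).symm
  · exact (pairwise_disjoint_unitBand (by simpa using h)).mono (unitCore_some_subset i)
      (unitCore_some_subset j)

lemma sqNorm_equiv_mixedNorm_unit (x : Option HaarIdx → ENNReal) :
    sqNorm idxCell x ≤ mixedNorm (x ∘ unitSplit) ∧
      mixedNorm (x ∘ unitSplit) ≤ 5 * sqNorm idxCell x := by
  rw [← sqNorm_comp_equiv (Equiv.ofBijective _ unitSplit_bijective), Equiv.coe_ofBijective,
    idxCell_comp_unitSplit]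
  refine ⟨sqNorm_assemble_le _ _ _, mixedNorm_le _ _ pairwise_disjoint_unitBand unitCore
    pairwise_disjoint_unitCore unitCore_subset (fun i => ?_) _⟩
  cases i <;> simp [unitTop, unitCore]

lemma sqNorm_equiv_mixedNorm_line (x : ℤ × ℤ → ENNReal) :
    sqNorm id x ≤ mixedNorm (x ∘ assemble topCell band) ∧
      mixedNorm (x ∘ assemble topCell band) ≤ 5 * sqNorm id x := by
  rw [← sqNorm_comp_equiv (Equiv.ofBijective _ assemble_band_bijective), Equiv.coe_ofBijective,
    Function.id_comp]
  have hcore : Pairwise (Function.onFun Disjoint fun i : ℤ × Bool =>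
      dyadicCell (band (i.1 - 1, i.2))) := by
    rintro ⟨m, s⟩ ⟨n, r⟩ h
    refine pairwise_disjoint_band (i := (m - 1, s)) (j := (n - 1, r)) fun h' => h ?_
    simp only [Prod.mk.injEq] at h'
    exact Prod.ext (by simpa using h'.1) h'.2
  refine ⟨sqNorm_assemble_le _ _ _, mixedNorm_le topCell band pairwise_disjoint_band
    (fun i => band (i.1 - 1, i.2)) hcore (fun i => band_subset_topCell i.1 i.2) (fun i => ?_) _⟩
  simp only [topCell, band]
  omega

/-- The dyadic Hardy space `H₁(δ)` on `[0,1]` is lattice-isomorphic to the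
dyadic Hardy space `H₁(δ∞)` on `ℝ`: the normalized unconditional Haar bases of the two
spaces are permutatively equivalent, i.e. there are a bijection `σ` between the index sets
and a constant `C > 0` such that for all finitely supported coefficients the normalized
expansions have equivalent norms. -/
theorem stmt14 :
    ∃ (σ : Option HaarIdx ≃ ℤ × ℤ) (C : ℝ), 0 < C ∧
      ∀ a : Option HaarIdx → ℝ, (Function.support a).Finite →
        C⁻¹ * H1deltaNorm (fun i => a i * (nu1 i)⁻¹) ≤
            H1deltaInfNorm (fun q => a (σ.symm q) * (nuR q)⁻¹) ∧
          H1deltaInfNorm (fun q => a (σ.symm q) * (nuR q)⁻¹) ≤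
            C * H1deltaNorm (fun i => a i * (nu1 i)⁻¹) := by
  obtain ⟨eA⟩ : Nonempty (Option ℕ ≃ ℤ × Bool) := nonempty_equiv_of_countable
  obtain ⟨eB⟩ : Nonempty (ℕ ≃ ℤ × Bool) := nonempty_equiv_of_countable
  set e := Equiv.sumCongr eA (Equiv.prodCongr eB (Equiv.refl HaarIdx)) with he
  set σ : Option HaarIdx ≃ ℤ × ℤ := (Equiv.ofBijective _ unitSplit_bijective).symm.trans
    (e.trans (Equiv.ofBijective _ assemble_band_bijective)) with hσ
  refine ⟨σ, 5, by norm_num, fun a ha => ?_⟩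
  have ha' : (Function.support (a ∘ σ.symm)).Finite := by
    rw [Function.support_comp_eq_preimage]
    exact ha.preimage σ.symm.injective.injOn
  set x : Option HaarIdx → ENNReal := fun i => ENNReal.ofReal |a i| with hx
  have hmix : mixedNorm ((x ∘ σ.symm) ∘ assemble topCell band) = mixedNorm (x ∘ unitSplit) := by
    rw [← mixedNorm_comp_equiv eA eB, ← he]
    congr 1
    funext i
    have : σ (unitSplit i) = assemble topCell band (e i) := by
      simp only [hσ, Equiv.trans_apply, Equiv.ofBijective_apply]
      rw [Equiv.ofBijective_symm_apply_apply]
    simp [← this]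
  have h1 := sqNorm_equiv_mixedNorm_unit x
  have h2 := sqNorm_equiv_mixedNorm_line (x ∘ σ.symm)
  rw [hmix] at h2
  have hN1 := H1deltaNorm_eq a ha
  have hN2 := H1deltaInfNorm_eq (a ∘ σ.symm) ha'
  have ht1 : sqNorm idxCell x ≠ ⊤ := sqNorm_ne_top idxCell a ha
  have ht2 : sqNorm id (x ∘ σ.symm) ≠ ⊤ := sqNorm_ne_top id (a ∘ σ.symm) ha'
  have key {u v : ENNReal} (hv : v ≠ ⊤) (h : u ≤ 5 * v) : u.toReal ≤ 5 * v.toReal := by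
    simpa using ENNReal.toReal_mono (ENNReal.mul_ne_top (by norm_num) hv) h
  have k1 := key ht2 (h1.1.trans h2.2)
  have k2 := key ht1 (h2.1.trans h1.2)
  change H1deltaInfNorm (fun q => a (σ.symm q) * (nuR q)⁻¹) = _ at hN2
  rw [hN1, hN2]
  exact ⟨by rw [inv_mul_le_iff₀ (by norm_num)]; exact k1, k2⟩
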